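/- For every integer d ≥ 3 there exists a constant C_d > 0 such that for all integers n ≥ d+1 one has Δ_{d,d}(n) ≤ C_d · n^{−(ln d − 6 + 10·d^{−1/2})}, where ln denotes the natural logarithm. -/

import Mathlib

open scoped RealInnerProductSpace

/-- The Gram matrix of a collection of `k` vectors in `ℝ^d`. -/
noncomputable def gram {d k : ℕ} (v : Fin k → EuclideanSpace ℝ (Fin d)) :
    Matrix (Fin k) (Fin k) ℝ :=
  Matrix.of fun i j => ⟪v i, v j⟫

/-- `vol v` is the `k`-dimensional volume of the parallelepiped spanned by
`v 1, …, v k`, i.e. the square root of the determinant of their Gram matrix.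
For `k = 0` it equals `1`. -/
noncomputable def vol {d k : ℕ} (v : Fin k → EuclideanSpace ℝ (Fin d)) : ℝ :=
  Real.sqrt (gram v).det

/-- The `k`-dimensional volume of the simplex with vertices `p 0, …, p k`. -/
noncomputable def simplexVol {d k : ℕ} (p : Fin (k + 1) → EuclideanSpace ℝ (Fin d)) : ℝ :=
  (Nat.factorial k : ℝ)⁻¹ * vol (fun i : Fin k => p i.succ - p 0)

/-- The minimum, over all `(k+1)`-element subsets of `X`, of the `k`-dimensional
volume of the simplex they span. -/
noncomputable def minSimplexVol (d k : ℕ) (X : Finset (EuclideanSpace ℝ (Fin d))) : ℝ :=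
  sInf { v : ℝ | ∃ p : Fin (k + 1) → EuclideanSpace ℝ (Fin d),
    Function.Injective p ∧ (∀ i, p i ∈ X) ∧ v = simplexVol p }

/-- `Delta k d n` is the supremum, over all `n`-element subsets `X` of the unit cube
`[0,1]^d`, of the minimum `k`-dimensional simplex volume among `(k+1)`-element
subsets of `X`. -/
noncomputable def Delta (k d n : ℕ) : ℝ :=
  sSup { v : ℝ | ∃ X : Finset (EuclideanSpace ℝ (Fin d)), X.card = n ∧
    (∀ x ∈ X, ∀ i, x i ∈ Set.Icc (0 : ℝ) 1) ∧ v = minSimplexVol d k X }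

/-- Gaussian elimination of one row with a pivot of maximal modulus: it is a linear map killing
`u`, of norm at most `2`, which reduces determinants with first row `u` to one dimension less. -/
lemma exists_pivot_elimination {D : ℕ} (u : Fin (D + 1) → ℝ) :
    ∃ L : (Fin (D + 1) → ℝ) →ₗ[ℝ] (Fin D → ℝ), L u = 0 ∧ (∀ w, ‖L w‖ ≤ 2 * ‖w‖) ∧
      ∀ w : Fin D → Fin (D + 1) → ℝ,
        |(Matrix.of (Fin.cons u w : Fin (D + 1) → Fin (D + 1) → ℝ)).det| ≤
          ‖u‖ * |(Matrix.of fun i => L (w i)).det| := by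
  rcases eq_or_ne u 0 with rfl | hu
  · refine ⟨0, rfl, fun w => by simp, fun w => ?_⟩
    rw [Matrix.det_eq_zero_of_row_eq_zero (0 : Fin (D + 1)) (by intro j; simp)]
    simp
  obtain ⟨j, hj⟩ : ∃ j, ‖u‖ = |u j| := by
    obtain ⟨j, -, hj⟩ := Finset.exists_max_image Finset.univ (fun j => |u j|) ⟨0, by simp⟩
    refine ⟨j, le_antisymm ((pi_norm_le_iff_of_nonneg (abs_nonneg _)).2 fun i => ?_)
      (norm_le_pi_norm u j)⟩
    exact hj i (by simp)
  have huj : 0 < |u j| := hj ▸ norm_pos_iff.2 hu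
  have huj0 : u j ≠ 0 := abs_pos.1 huj
  let L : (Fin (D + 1) → ℝ) →ₗ[ℝ] (Fin D → ℝ) :=
    { toFun := fun w i => w (j.succAbove i) - w j / u j * u (j.succAbove i)
      map_add' := fun v w => by ext i; simp only [Pi.add_apply]; ring
      map_smul' := fun c w => by
        ext i; simp only [Pi.smul_apply, smul_eq_mul, RingHom.id_apply]; ring }
  have hL : ∀ w i, L w i = w (j.succAbove i) - w j / u j * u (j.succAbove i) := fun _ _ => rfl
  refine ⟨L, ?_, fun w => ?_, fun w => ?_⟩
  · ext i
    rw [hL, div_self huj0]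
    simp
  · refine (pi_norm_le_iff_of_nonneg (by positivity)).2 fun i => ?_
    have h1 : |w (j.succAbove i)| ≤ ‖w‖ := norm_le_pi_norm w _
    have h2 : |w j| ≤ ‖w‖ := norm_le_pi_norm w _
    have h3 : |u (j.succAbove i)| ≤ |u j| := hj ▸ norm_le_pi_norm u _
    have h4 : |w j / u j * u (j.succAbove i)| ≤ ‖w‖ := by
      rw [abs_mul, abs_div, div_mul_eq_mul_div, div_le_iff₀ huj]
      exact mul_le_mul h2 h3 (abs_nonneg _) (norm_nonneg _)
    rw [hL, Real.norm_eq_abs]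
    linarith [abs_sub (w (j.succAbove i)) (w j / u j * u (j.succAbove i))]
  · let v : Fin D → Fin (D + 1) → ℝ := fun i k => w i k - w i j / u j * u k
    have hrow : (Matrix.of (Fin.cons u w : Fin (D + 1) → Fin (D + 1) → ℝ)).det =
        (Matrix.of (Fin.cons u v : Fin (D + 1) → Fin (D + 1) → ℝ)).det := by
      refine Matrix.det_eq_of_forall_row_eq_smul_add_const
        (Fin.cons 0 fun i => w i j / u j) 0 rfl ?_
      intro i k
      refine Fin.cases ?_ (fun i => ?_) i
      · simp
      · simp [v]
    have hexp : (Matrix.of (Fin.cons u v : Fin (D + 1) → Fin (D + 1) → ℝ)).det =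
        (-1) ^ (j : ℕ) * u j * (Matrix.of fun i => L (w i)).det := by
      rw [Matrix.det_succ_column _ j, Fin.sum_univ_succ, Finset.sum_eq_zero]
      · simp only [Matrix.of_apply, Fin.cons_zero, Fin.val_zero, zero_add, add_zero]
        congr 1
      · intro i _
        simp [v, huj0]
    rw [hrow, hexp, hj, abs_mul, abs_mul, abs_pow, abs_neg, abs_one, one_pow, one_mul]

/-- `N` points of a cube contain a cluster of `s + 1` points of diameter `O(N ^ (-1 / D))`. -/
lemma exists_cluster {α : Type*} {D s : ℕ} (hD : D ≠ 0) {R : ℝ} (hR : 0 ≤ R) {S : Finset α}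
    {y : α → Fin D → ℝ} (hs : s + 1 ≤ S.card) (hy : ∀ i ∈ S, ‖y i‖ ≤ R) :
    ∃ A ⊆ S, A.card = s + 1 ∧ ∀ i ∈ A, ∀ j ∈ A,
      ‖y i - y j‖ ≤ 4 * (R + 1) * (S.card / (s + 1) : ℝ) ^ (-(1 / D : ℝ)) := by
  classical
  set q : ℝ := (S.card / (s + 1) : ℝ) ^ (1 / D : ℝ) with hq
  have hs' : (s + 1 : ℝ) ≤ S.card := by exact_mod_cast hs
  have hbase : (1 : ℝ) ≤ S.card / (s + 1) := by rwa [le_div_iff₀ (by positivity), one_mul]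
  have hq1 : 1 ≤ q := Real.one_le_rpow hbase (by positivity)
  set m : ℕ := ⌊q⌋₊ with hm
  have hm1 : 1 ≤ m := Nat.le_floor (by simpa using hq1)
  have hm0 : (0 : ℝ) < m := by exact_mod_cast hm1
  have hqm : q ≤ 2 * m := by
    have h1 := Nat.lt_floor_add_one q
    have h2 : (1 : ℝ) ≤ m := by exact_mod_cast hm1
    linarith
  have hmD : m ^ D * s < S.card := by
    have h1 : (m : ℝ) ^ D ≤ q ^ D :=
      pow_le_pow_left₀ hm0.le (Nat.floor_le (by linarith)) _
    have h2 : q ^ D = S.card / (s + 1) := by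
      rw [hq, one_div]
      exact Real.rpow_inv_natCast_pow (by positivity) hD
    rw [h2, le_div_iff₀ (by positivity)] at h1
    have h3 : m ^ D * (s + 1) ≤ S.card := by exact_mod_cast h1
    have h4 : 0 < m ^ D := by positivity
    linarith
  have hR1 : 0 < R + 1 := by linarith
  let c : α → Fin D → ℕ := fun i k => ⌊(y i k + (R + 1)) / (2 * (R + 1)) * m⌋₊
  have hcoord : ∀ i ∈ S, ∀ k, |y i k| ≤ R := fun i hi k => (norm_le_pi_norm _ k).trans (hy i hi)
  have hpos : ∀ i ∈ S, ∀ k, 0 ≤ (y i k + (R + 1)) / (2 * (R + 1)) * m := by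
    intro i hi k
    have := (abs_le.1 (hcoord i hi k)).1
    have : 0 ≤ y i k + (R + 1) := by linarith
    positivity
  have hc : ∀ i ∈ S, c i ∈ Fintype.piFinset fun _ : Fin D => Finset.range m := by
    intro i hi
    rw [Fintype.mem_piFinset]
    intro k
    rw [Finset.mem_range, Nat.floor_lt (hpos i hi k)]
    have := (abs_le.1 (hcoord i hi k)).2
    have h : (y i k + (R + 1)) / (2 * (R + 1)) < 1 := by
      rw [div_lt_one (by positivity)]
      linarith
    nlinarith
  obtain ⟨z, -, hz⟩ := Finset.exists_lt_card_fiber_of_mul_lt_card_of_maps_to (n := s) hc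
    (by simpa using hmD)
  obtain ⟨A, hA, hAcard⟩ := Finset.exists_subset_card_eq (Nat.succ_le_of_lt hz)
  refine ⟨A, hA.trans (Finset.filter_subset _ _), hAcard, fun i hi j hj => ?_⟩
  obtain ⟨hiS, hiz⟩ := Finset.mem_filter.1 (hA hi)
  obtain ⟨hjS, hjz⟩ := Finset.mem_filter.1 (hA hj)
  have hrho : 2 * (R + 1) / m ≤ 4 * (R + 1) * (S.card / (s + 1) : ℝ) ^ (-(1 / D : ℝ)) := by
    rw [Real.rpow_neg (by positivity), ← hq, ← div_eq_mul_inv,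
      div_le_div_iff₀ hm0 (by linarith)]
    nlinarith
  refine le_trans ((pi_norm_le_iff_of_nonneg (by positivity)).2 fun k => ?_) hrho
  have hik : ⌊(y i k + (R + 1)) / (2 * (R + 1)) * m⌋₊ = z k := congrFun hiz k
  have hjk : ⌊(y j k + (R + 1)) / (2 * (R + 1)) * m⌋₊ = z k := congrFun hjz k
  have hi1 := (Nat.floor_eq_iff (hpos i hiS k)).1 hik
  have hj1 := (Nat.floor_eq_iff (hpos j hjS k)).1 hjk
  have hdiff : (y i k - y j k) * (m / (2 * (R + 1))) =
      (y i k + (R + 1)) / (2 * (R + 1)) * m - (y j k + (R + 1)) / (2 * (R + 1)) * m := by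
    ring
  have hlt : |(y i k - y j k) * (m / (2 * (R + 1)))| ≤ 1 := by
    rw [hdiff, abs_le]
    constructor <;> linarith [hi1.1, hi1.2, hj1.1, hj1.2]
  rw [abs_mul, abs_of_pos (by positivity : (0 : ℝ) < m / (2 * (R + 1)))] at hlt
  rw [Pi.sub_apply, Real.norm_eq_abs, le_div_iff₀ hm0]
  have := mul_le_mul_of_nonneg_right hlt (by positivity : (0 : ℝ) ≤ 2 * (R + 1))
  rwa [mul_assoc, div_mul_cancel₀ _ (by positivity), one_mul] at this

/-- Among any `≳ n` vectors of bounded norm in `ℝ^D` there are `D` ones whose determinant is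
`O(n ^ (-g))`. -/
def HasDetBound (α : Type*) (D : ℕ) (g : ℝ) : Prop :=
  ∀ R K : ℝ, 0 ≤ R → 0 < K → ∃ C : ℝ, 0 < C ∧
    ∀ (n : ℝ) (S : Finset α) (y : α → Fin D → ℝ), 1 ≤ n → D ≤ S.card →
      n ≤ K * (S.card + 1) → (∀ i ∈ S, ‖y i‖ ≤ R) →
        ∃ p : Fin D → α, Function.Injective p ∧ (∀ i, p i ∈ S) ∧
          |(Matrix.of fun i => y (p i)).det| ≤ C * n ^ (-g)

lemma hasDetBound_zero (α : Type*) : HasDetBound α 0 0 := by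
  intro R K _ _
  exact ⟨1, one_pos, fun n S y _ _ _ _ =>
    ⟨Fin.elim0, fun i => i.elim0, fun i => i.elim0, by simp⟩⟩

lemma HasDetBound.mono {α : Type*} {D : ℕ} {g g' : ℝ} (h : HasDetBound α D g) (hg : g' ≤ g) :
    HasDetBound α D g' := by
  intro R K hR hK
  obtain ⟨C, hC, H⟩ := h R K hR hK
  refine ⟨C, hC, fun n S y hn hS hnS hy => ?_⟩
  obtain ⟨p, hp, hpS, hdet⟩ := H n S y hn hS hnS hy
  refine ⟨p, hp, hpS, hdet.trans ?_⟩
  gcongr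

/-- Complementing `s` short vectors by the vectors that a determinant bound provides. -/
lemma HasDetBound.exists_short {α : Type*} {b : ℕ} {g : ℝ} (h : HasDetBound α b g) (s : ℕ) :
    ∀ R K : ℝ, 0 ≤ R → 0 < K → ∃ C : ℝ, 0 < C ∧
      ∀ (n ρ : ℝ) (T S : Finset α) (y : α → Fin (b + s) → ℝ), 1 ≤ n → 0 ≤ ρ → T.card = s →
        Disjoint T S → b ≤ S.card → n ≤ K * (S.card + 1) → (∀ i ∈ S, ‖y i‖ ≤ R) →
        (∀ i ∈ T, ‖y i‖ ≤ ρ) →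
          ∃ p : Fin (b + s) → α, Function.Injective p ∧ (∀ i, p i ∈ T ∨ p i ∈ S) ∧
            |(Matrix.of fun i => y (p i)).det| ≤ C * ρ ^ s * n ^ (-g) := by
  classical
  induction s with
  | zero =>
    intro R K hR hK
    obtain ⟨C, hC, H⟩ := h R K hR hK
    refine ⟨C, hC, fun n ρ T S y hn _ _ _ hb hnS hy _ => ?_⟩
    obtain ⟨p, hp, hpS, hdet⟩ := H n S y hn hb hnS hy
    exact ⟨p, hp, fun i => Or.inr (hpS i), by simpa using hdet⟩
  | succ s ih =>
    intro R K hR hK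
    obtain ⟨C, hC, H⟩ := ih (2 * R) K (by positivity) hK
    refine ⟨C * 2 ^ s, by positivity, fun n ρ T S y hn hρ hT hTS hb hnS hy hyT => ?_⟩
    obtain ⟨t, T', htT', rfl, hT'⟩ := Finset.card_eq_succ.1 hT
    obtain ⟨L, -, hL, hdetL⟩ := exists_pivot_elimination (D := b + s) (y t)
    rw [Finset.disjoint_insert_left] at hTS
    obtain ⟨p, hp, hpS, hdet⟩ := H n (2 * ρ) T' S (fun i => L (y i)) hn (by positivity) hT'
      hTS.2 hb hnS
      (fun i hi => (hL _).trans (by linarith [hy i hi]))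
      (fun i hi => (hL _).trans (by linarith [hyT i (Finset.mem_insert_of_mem hi)]))
    refine ⟨Fin.cons t p, ?_, ?_, ?_⟩
    · rw [Fin.cons_injective_iff]
      refine ⟨?_, hp⟩
      rintro ⟨i, hi⟩
      rcases hpS i with h | h
      · exact htT' (hi ▸ h)
      · exact hTS.1 (hi ▸ h)
    · intro i
      refine Fin.cases (Or.inl (by simp)) (fun i => ?_) i
      rw [Fin.cons_succ]
      exact (hpS i).imp Finset.mem_insert_of_mem id
    · have hcons : (fun i => y ((Fin.cons t p : Fin (b + s + 1) → α) i)) =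
          (Fin.cons (y t) fun i => y (p i) : Fin (b + s + 1) → Fin (b + s + 1) → ℝ) := by
        ext i
        refine Fin.cases ?_ (fun i => ?_) i <;> simp
      change |(Matrix.of fun i => y ((Fin.cons t p : Fin (b + s + 1) → α) i)).det| ≤ _
      rw [hcons]
      refine (hdetL fun i => y (p i)).trans ?_
      have h1 := mul_le_mul (hyT t (by simp)) hdet (abs_nonneg _) hρ
      refine h1.trans (le_of_eq ?_)
      rw [mul_pow]
      ring

/-- The diameter of a cluster among `≳ n` points, raised to the power `s`. -/
lemma cluster_diam_pow_le {D s : ℕ} {R K n N : ℝ} (hR : 0 ≤ R) (hK : 0 < K) (hn : 1 ≤ n)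
    (hN : 1 ≤ N) (hnN : n ≤ K * (N + 1)) :
    (2 * (4 * (R + 1) * (N / (s + 1)) ^ (-(1 / D : ℝ)))) ^ s ≤
      (8 * (R + 1) * (2 * K * (s + 1)) ^ (1 / D : ℝ)) ^ s * n ^ (-(s / D : ℝ)) := by
  have hn0 : 0 < n := by linarith
  have h1 : (N / (s + 1)) ^ (-(1 / D : ℝ)) ≤ (n / (2 * K * (s + 1))) ^ (-(1 / D : ℝ)) := by
    refine Real.rpow_le_rpow_of_nonpos (by positivity) ?_ (by simp)
    rw [div_le_div_iff₀ (by positivity) (by positivity)]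
    have : n ≤ N * (2 * K) := by nlinarith
    nlinarith [mul_le_mul_of_nonneg_right this (by positivity : (0 : ℝ) ≤ s + 1)]
  have h2 : (n / (2 * K * (s + 1))) ^ (-(1 / D : ℝ)) =
      (2 * K * (s + 1)) ^ (1 / D : ℝ) * n ^ (-(1 / D : ℝ)) := by
    rw [Real.div_rpow hn0.le (by positivity),
      Real.rpow_neg (by positivity : (0 : ℝ) ≤ 2 * K * (s + 1)), div_inv_eq_mul, mul_comm]
  have h3 : n ^ (-(s / D : ℝ)) = (n ^ (-(1 / D : ℝ))) ^ s := by
    rw [← Real.rpow_natCast, ← Real.rpow_mul hn0.le]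
    congr 1
    ring
  rw [h3, ← mul_pow]
  refine pow_le_pow_left₀ (by positivity) ?_ _
  rw [h2] at h1
  nlinarith [mul_le_mul_of_nonneg_left h1 (by positivity : (0 : ℝ) ≤ 8 * (R + 1))]

/-- Linking a cluster of `s + 1` points to the origin uses up `s + 1` dimensions. -/
lemma HasDetBound.add_cluster {α : Type*} {b : ℕ} {g : ℝ} (h : HasDetBound α b g) (s : ℕ) :
    HasDetBound α (b + s + 1) (g + s / (b + s + 1 : ℕ)) := by
  classical
  intro R K hR hK
  obtain ⟨C, hC, H⟩ := h.exists_short s (2 * R) (K * (s + 2)) (by positivity) (by positivity)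
  refine ⟨(R + 1) * (C * (8 * (R + 1) * (2 * K * (s + 1)) ^ (1 / (b + s + 1 : ℕ) : ℝ)) ^ s),
    by positivity, fun n S y hn hS hnS hy => ?_⟩
  obtain ⟨A, hAS, hA, hclose⟩ := exists_cluster (s := s) (by omega) hR (by omega) hy
  obtain ⟨a, T, haT, rfl, hT⟩ := Finset.card_eq_succ.1 hA
  obtain ⟨L, hLa, hL, hdetL⟩ := exists_pivot_elimination (D := b + s) (y a)
  have haS : a ∈ S := hAS (by simp)
  have hcard : (S \ insert a T).card + (s + 1) = S.card := by
    rw [← hA]; exact Finset.card_sdiff_add_card_eq_card hAS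
  have hcardR : ((S \ insert a T).card : ℝ) + (s + 1) = S.card := by exact_mod_cast hcard
  have hc0 : (0 : ℝ) ≤ (S \ insert a T).card := Nat.cast_nonneg _
  obtain ⟨p, hp, hpS, hdet⟩ := H n _ T (S \ insert a T) (fun i => L (y i)) hn
    (by positivity : (0 : ℝ) ≤ 2 * (4 * (R + 1) * (S.card / (s + 1)) ^
      (-(1 / (b + s + 1 : ℕ) : ℝ)))) hT
    (Finset.disjoint_sdiff.mono_left (Finset.subset_insert a T)) (by omega)
    (by
      rw [← hcardR] at hnS
      refine hnS.trans ?_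
      rw [mul_assoc]
      refine mul_le_mul_of_nonneg_left ?_ hK.le
      have hs0 : (0 : ℝ) ≤ s := Nat.cast_nonneg _
      nlinarith)
    (fun i hi => (hL _).trans (by linarith [hy i (Finset.mem_sdiff.1 hi).1]))
    (fun i hi => by
      have : L (y i) = L (y i - y a) := by rw [map_sub, hLa, sub_zero]
      rw [this]
      refine (hL _).trans ?_
      linarith [hclose i (Finset.mem_insert_of_mem hi) a (by simp)])
  refine ⟨Fin.cons a p, ?_, ?_, ?_⟩
  · rw [Fin.cons_injective_iff]
    refine ⟨?_, hp⟩
    rintro ⟨i, hi⟩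
    rcases hpS i with h | h
    · exact haT (hi ▸ h)
    · exact (Finset.mem_sdiff.1 h).2 (by simp [hi])
  · intro i
    refine Fin.cases haS (fun i => ?_) i
    rw [Fin.cons_succ]
    rcases hpS i with h | h
    · exact hAS (Finset.mem_insert_of_mem h)
    · exact (Finset.mem_sdiff.1 h).1
  · have hcons : (fun i => y ((Fin.cons a p : Fin (b + s + 1) → α) i)) =
        (Fin.cons (y a) fun i => y (p i) : Fin (b + s + 1) → Fin (b + s + 1) → ℝ) := by
      ext i
      refine Fin.cases ?_ (fun i => ?_) i <;> simp
    rw [hcons]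
    refine (hdetL fun i => y (p i)).trans ?_
    have hN : (1 : ℝ) ≤ S.card := by exact_mod_cast (by omega : 1 ≤ S.card)
    have hdiam := cluster_diam_pow_le (D := b + s + 1) (s := s) hR hK hn hN hnS
    have hyR : ‖y a‖ ≤ R + 1 := (hy a haS).trans (by linarith)
    refine (mul_le_mul hyR (hdet.trans (mul_le_mul_of_nonneg_right
      (mul_le_mul_of_nonneg_left hdiam hC.le) (by positivity))) (abs_nonneg _)
      (by positivity)).trans (le_of_eq ?_)
    rw [neg_add, Real.rpow_add (by linarith)]
    ring

/-- Points of the unit cube: a cluster of `s + 1` points, complemented by a determinant bound in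
the remaining dimensions, spans a simplex of small determinant. -/
lemma HasDetBound.exists_simplex {d b s : ℕ} {g : ℝ}
    (h : HasDetBound (EuclideanSpace ℝ (Fin d)) b g) (hd : d ≠ 0) (hbs : d = b + s) :
    ∃ C : ℝ, 0 < C ∧ ∀ (n : ℕ) (X : Finset (EuclideanSpace ℝ (Fin d))), d + 1 ≤ n →
      X.card = n → (∀ x ∈ X, ∀ i, x i ∈ Set.Icc (0 : ℝ) 1) →
        ∃ p : Fin (d + 1) → EuclideanSpace ℝ (Fin d), Function.Injective p ∧ (∀ i, p i ∈ X) ∧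
          |(Matrix.of fun i j => (p (Fin.succ i) - p 0) j : Matrix (Fin d) (Fin d) ℝ).det| ≤
            C * (n : ℝ) ^ (-(g + s / d)) := by
  classical
  obtain ⟨C, hC, H⟩ := h.exists_short s 1 (s + 2) zero_le_one (by positivity)
  rw [← hbs] at H
  refine ⟨C * (8 * (1 + 1) * (2 * 1 * (s + 1)) ^ (1 / d : ℝ)) ^ s, by positivity,
    fun n X hn hX hcube => ?_⟩
  have hnorm : ∀ x ∈ X, ∀ x' ∈ X, ‖fun j => x j - x' j‖ ≤ 1 := by
    intro x hx x' hx'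
    refine (pi_norm_le_iff_of_nonneg zero_le_one).2 fun j => ?_
    rw [Real.norm_eq_abs, abs_le]
    constructor <;> linarith [(hcube x hx j).1, (hcube x hx j).2, (hcube x' hx' j).1,
      (hcube x' hx' j).2]
  have hy : ∀ x ∈ X, ‖(fun j => x j : Fin d → ℝ)‖ ≤ 1 := by
    intro x hx
    refine (pi_norm_le_iff_of_nonneg zero_le_one).2 fun j => ?_
    rw [Real.norm_eq_abs, abs_le]
    constructor <;> linarith [(hcube x hx j).1, (hcube x hx j).2]
  obtain ⟨A, hAX, hA, hclose⟩ := exists_cluster (s := s)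
    (y := fun (x : EuclideanSpace ℝ (Fin d)) (j : Fin d) => x j) hd zero_le_one
    (by omega) hy
  obtain ⟨a, T, haT, rfl, hT⟩ := Finset.card_eq_succ.1 hA
  have haX : a ∈ X := hAX (by simp)
  have hcard : (X \ insert a T).card + (s + 1) = X.card := by
    rw [← hA]; exact Finset.card_sdiff_add_card_eq_card hAX
  have hcardR : ((X \ insert a T).card : ℝ) + (s + 1) = n := by rw [← hX]; exact_mod_cast hcard
  have hc0 : (0 : ℝ) ≤ (X \ insert a T).card := Nat.cast_nonneg _
  have hs0 : (0 : ℝ) ≤ s := Nat.cast_nonneg _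
  have hn1 : (1 : ℝ) ≤ n := by exact_mod_cast (by omega : 1 ≤ n)
  obtain ⟨p, hp, hpX, hdet⟩ := H n
    (2 * (4 * (1 + 1) * (X.card / (s + 1)) ^ (-(1 / d : ℝ)))) T (X \ insert a T)
    (fun x j => x j - a j) hn1 (by positivity) hT
    (Finset.disjoint_sdiff.mono_left (Finset.subset_insert a T)) (by omega) (by nlinarith)
    (fun x hx => hnorm x (Finset.mem_sdiff.1 hx).1 a haX)
    (fun x hx => (hclose x (Finset.mem_insert_of_mem hx) a (by simp)).trans (by
      have : (0 : ℝ) ≤ 4 * (1 + 1) * (X.card / (s + 1)) ^ (-(1 / d : ℝ)) := by positivity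
      linarith))
  refine ⟨Fin.cons a p, ?_, ?_, ?_⟩
  · rw [Fin.cons_injective_iff]
    refine ⟨?_, hp⟩
    rintro ⟨i, hi⟩
    rcases hpX i with h | h
    · exact haT (hi ▸ h)
    · exact (Finset.mem_sdiff.1 h).2 (by simp [hi])
  · intro i
    refine Fin.cases haX (fun i => ?_) i
    rw [Fin.cons_succ]
    rcases hpX i with h | h
    · exact hAX (Finset.mem_insert_of_mem h)
    · exact (Finset.mem_sdiff.1 h).1
  · have hdiam := cluster_diam_pow_le (D := d) (s := s) (K := 1) (N := X.card) zero_le_one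
      one_pos hn1 (by rw [hX]; exact hn1) (by rw [hX]; linarith)
    simp only [Fin.cons_succ, Fin.cons_zero, PiLp.sub_apply]
    refine (hdet.trans (mul_le_mul_of_nonneg_right
      (mul_le_mul_of_nonneg_left hdiam hC.le) (by positivity))).trans (le_of_eq ?_)
    rw [neg_add, Real.rpow_add (by linarith)]
    ring

lemma vol_eq_abs_det {d : ℕ} (v : Fin d → EuclideanSpace ℝ (Fin d)) :
    vol v = |(Matrix.of fun i j => v i j : Matrix (Fin d) (Fin d) ℝ).det| := by
  have hgram : gram v = (Matrix.of fun i j => v i j : Matrix (Fin d) (Fin d) ℝ) *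
      (Matrix.of fun i j => v i j : Matrix (Fin d) (Fin d) ℝ).transpose := by
    ext i j
    simp [gram, Matrix.mul_apply, PiLp.inner_apply, mul_comm]
  rw [vol, hgram, Matrix.det_mul, Matrix.det_transpose, ← sq, Real.sqrt_sq_eq_abs]

lemma simplexVol_nonneg {d k : ℕ} (p : Fin (k + 1) → EuclideanSpace ℝ (Fin d)) :
    0 ≤ simplexVol p :=
  mul_nonneg (by positivity) (Real.sqrt_nonneg _)

lemma HasDetBound.exists_delta_le {d b s : ℕ} {g e : ℝ}
    (h : HasDetBound (EuclideanSpace ℝ (Fin d)) b g) (hd : d ≠ 0) (hbs : d = b + s)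
    (he : e ≤ g + s / d) :
    ∃ C : ℝ, 0 < C ∧ ∀ n : ℕ, d + 1 ≤ n → Delta d d n ≤ C * (n : ℝ) ^ (-e) := by
  obtain ⟨C, hC, H⟩ := h.exists_simplex hd hbs
  refine ⟨C, hC, fun n hn => Real.sSup_le ?_ (by positivity)⟩
  rintro v ⟨X, hX, hcube, rfl⟩
  obtain ⟨p, hp, hpX, hdet⟩ := H n X hn hX hcube
  have hbdd : BddBelow { v : ℝ | ∃ p : Fin (d + 1) → EuclideanSpace ℝ (Fin d),
      Function.Injective p ∧ (∀ i, p i ∈ X) ∧ v = simplexVol p } :=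
    ⟨0, by rintro _ ⟨p, -, -, rfl⟩; exact simplexVol_nonneg p⟩
  refine (csInf_le hbdd ⟨p, hp, hpX, rfl⟩).trans ?_
  have hfact : ((d.factorial : ℝ))⁻¹ ≤ 1 :=
    inv_le_one_of_one_le₀ (by exact_mod_cast Nat.one_le_iff_ne_zero.2 d.factorial_ne_zero)
  have hn1 : (1 : ℝ) ≤ n := by exact_mod_cast (by omega : 1 ≤ n)
  rw [simplexVol, vol_eq_abs_det]
  refine (mul_le_of_le_one_left (abs_nonneg _) hfact).trans (hdet.trans ?_)
  gcongr

/-- The exponent `log D - 6 + 10 / √D` gains at most `s / D` when `s + 1 ≈ √D` dimensions are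
added to reach `D`. -/
lemma log_exponent_step {D b s : ℕ} (hD : 16 ≤ D) (hbs : D = b + s + 1)
    (hlow : Real.sqrt D ≤ s + 1) (hup : (s : ℝ) ≤ Real.sqrt D) :
    Real.log D - 6 + 10 / Real.sqrt D ≤ Real.log b - 6 + 10 / Real.sqrt b + s / D := by
  have hD' : (16 : ℝ) ≤ D := by exact_mod_cast hD
  set x := Real.sqrt D with hx
  have hx4 : 4 ≤ x := by
    rw [hx]; exact Real.le_sqrt_of_sq_le (by linarith)
  have hxx : (D : ℝ) = x ^ 2 := (Real.sq_sqrt (by linarith)).symm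
  set t : ℝ := s + 1 with ht
  have hb : (b : ℝ) = x ^ 2 - t := by
    rw [← hxx, hbs, ht]; push_cast; ring
  have htx : t ≤ x + 1 := by linarith
  have hb0 : 0 < x ^ 2 - t := by nlinarith
  set z := Real.sqrt b with hz
  have hzz : z ^ 2 = x ^ 2 - t := by rw [hz, Real.sq_sqrt (Nat.cast_nonneg _), hb]
  have hz0 : 0 < z := Real.sqrt_pos.2 (by rw [hb]; exact hb0)
  have hlog : Real.log D - Real.log b ≤ t / (x ^ 2 - t) := by
    rw [← Real.log_div (by rw [hxx]; positivity) (by rw [hb]; positivity), hxx, hb]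
    refine (Real.log_le_sub_one_of_pos (by positivity)).trans (le_of_eq ?_)
    field_simp
    ring
  have hzx : z ≤ x - t / (2 * x) := by
    have h0 : 0 ≤ x - t / (2 * x) := by
      rw [sub_nonneg, div_le_iff₀ (by positivity)]
      nlinarith
    refine le_of_sq_le_sq ?_ h0
    rw [hzz]
    have : (x - t / (2 * x)) ^ 2 = x ^ 2 - t + (t / (2 * x)) ^ 2 := by
      field_simp
      ring
    rw [this]
    nlinarith [sq_nonneg (t / (2 * x))]
  have hinv : 10 / x + 5 * t / x ^ 3 ≤ 10 / z := by
    rw [le_div_iff₀ hz0]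
    have h1 : (10 / x + 5 * t / x ^ 3) * z ≤ (10 / x + 5 * t / x ^ 3) * (x - t / (2 * x)) :=
      mul_le_mul_of_nonneg_left hzx (by positivity)
    refine h1.trans ?_
    have h2 : (10 / x + 5 * t / x ^ 3) * (x - t / (2 * x)) = 10 - 5 * t ^ 2 / (2 * x ^ 4) := by
      field_simp
      ring
    rw [h2]
    have : 0 ≤ 5 * t ^ 2 / (2 * x ^ 4) := by positivity
    linarith
  have hs : (s : ℝ) = t - 1 := by rw [ht]; ring
  have key : t / (x ^ 2 - t) ≤ 5 * t / x ^ 3 + (t - 1) / x ^ 2 := by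
    have h1 : 5 * t / x ^ 3 + (t - 1) / x ^ 2 = (5 * t + (t - 1) * x) / x ^ 3 := by
      field_simp
    rw [h1, div_le_div_iff₀ hb0 (by positivity)]
    nlinarith [mul_nonneg (sub_nonneg.2 hlow) (sub_nonneg.2 htx),
      mul_nonneg (mul_nonneg (sub_nonneg.2 hlow) (sub_nonneg.2 htx)) (by linarith : (0:ℝ) ≤ x),
      mul_nonneg (sub_nonneg.2 hlow) (sub_nonneg.2 hx4),
      mul_nonneg (mul_nonneg (sub_nonneg.2 hlow) (sub_nonneg.2 hx4)) (by linarith : (0:ℝ) ≤ x),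
      mul_nonneg (sub_nonneg.2 hx4) (sub_nonneg.2 hx4)]
  have hsD : (s : ℝ) / D = (t - 1) / x ^ 2 := by rw [hs, hxx]
  linarith

lemma log_exponent_le_of_lt {D : ℕ} (h4 : 4 ≤ D) (h16 : D < 16) :
    Real.log D - 6 + 10 / Real.sqrt D ≤ 3 / 4 := by
  have h4' : (4 : ℝ) ≤ D := by exact_mod_cast h4
  have h16' : (D : ℝ) ≤ 16 := by exact_mod_cast h16.le
  set x := Real.sqrt D with hx
  have hxx : (D : ℝ) = x ^ 2 := (Real.sq_sqrt (by linarith)).symm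
  have hx2 : 2 ≤ x := by
    rw [hx]; exact Real.le_sqrt_of_sq_le (by linarith)
  have hx4 : x ≤ 4 := by
    rw [hx]; exact Real.sqrt_le_iff.2 ⟨by norm_num, by linarith⟩
  have hlog : Real.log D ≤ 2 * Real.log 2 + (x - 2) := by
    have h1 := Real.log_le_sub_one_of_pos (by positivity : 0 < x / 2)
    rw [Real.log_div (by positivity) (by norm_num)] at h1
    rw [hxx, Real.log_pow]
    push_cast
    linarith
  have hdiv : 10 / x ≤ 15 / 2 - 5 / 4 * x := by
    rw [div_le_iff₀ (by positivity)]
    nlinarith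
  linarith [Real.log_two_lt_d9]

lemma hasDetBound_log (α : Type*) (D : ℕ) (hD : 4 ≤ D) :
    HasDetBound α D (Real.log D - 6 + 10 / Real.sqrt D) := by
  induction D using Nat.strong_induction_on with
  | _ D ih =>
    rcases lt_or_ge D 16 with h16 | h16
    · obtain ⟨s, rfl⟩ : ∃ s, D = 0 + s + 1 := ⟨D - 1, by omega⟩
      refine ((hasDetBound_zero α).add_cluster s).mono ((log_exponent_le_of_lt hD h16).trans ?_)
      have h3 : (3 : ℝ) ≤ s := by exact_mod_cast (by omega : 3 ≤ s)
      push_cast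
      rw [zero_add, zero_add, div_le_div_iff₀ (by norm_num) (by positivity)]
      linarith
    · have hD0 : (16 : ℝ) ≤ D := by exact_mod_cast h16
      obtain ⟨s, hs⟩ : ∃ s, s = ⌊Real.sqrt D⌋₊ := ⟨_, rfl⟩
      have hup : (s : ℝ) ≤ Real.sqrt D := hs ▸ Nat.floor_le (Real.sqrt_nonneg _)
      have hlow : Real.sqrt D ≤ s + 1 := hs ▸ (Nat.lt_floor_add_one _).le
      clear hs
      have hsq : s * s ≤ D := by
        have h1 : (s : ℝ) * s ≤ D := by
          rw [← Real.mul_self_sqrt (by linarith : (0 : ℝ) ≤ D)]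
          gcongr
        exact_mod_cast h1
      have hs4 : s + 5 ≤ D := by nlinarith
      obtain ⟨b, rfl⟩ : ∃ b, D = b + s + 1 := ⟨D - s - 1, by omega⟩
      exact ((ih b (by omega) (by omega)).add_cluster s).mono
        (log_exponent_step h16 rfl hlow hup)

/-- For every `d ≥ 3` there is a constant `C_d > 0` such that for all `n ≥ d + 1`,
`Δ_{d,d}(n) ≤ C_d · n^(-(ln d - 6 + 10·d^(-1/2)))`. -/
theorem delta_log_bound_refined (d : ℕ) (hd : 3 ≤ d) :
    ∃ C : ℝ, 0 < C ∧ ∀ n : ℕ, d + 1 ≤ n →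
      Delta d d n ≤
        C * (n : ℝ) ^ (-(Real.log d - 6 + 10 * (d : ℝ) ^ (-(1 / 2) : ℝ))) := by
  have hexp : 10 * (d : ℝ) ^ (-(1 / 2) : ℝ) = 10 / Real.sqrt d := by
    rw [Real.rpow_neg (Nat.cast_nonneg _), ← Real.sqrt_eq_rpow, div_eq_mul_inv]
  rw [hexp]
  rcases hd.eq_or_lt with rfl | hd
  · refine (hasDetBound_zero _).exists_delta_le (s := 3) (by norm_num) rfl ?_
    have hlog : Real.log 3 ≤ Real.log 2 + 1 / 2 := by
      have h1 := Real.log_le_sub_one_of_pos (by norm_num : (0 : ℝ) < 3 / 2)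
      rw [Real.log_div (by norm_num) (by norm_num)] at h1
      linarith
    have hsqrt : (1.73 : ℝ) ≤ Real.sqrt 3 := Real.le_sqrt_of_sq_le (by norm_num)
    have hdiv : 10 / Real.sqrt 3 ≤ 10 / 1.73 := by gcongr
    push_cast
    norm_num at hdiv ⊢
    linarith [Real.log_two_lt_d9]
  · exact (hasDetBound_log _ d hd).exists_delta_le (s := 0) (by omega) rfl (by simp)
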